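/- arXiv:1501.01945 — 3 statements merged into one kernel-verified Lean document; each statement's English description precedes it below -/
import Mathlib

section
/- Let T > 0 and μ, a, b > 0. Let f ∈ L^1(0,T) be a nonnegative measurable function satisfying f(t) ≤ a + b·∫_0^t (t-s)^{μ-1} f(s) ds for almost every t ∈ (0,T). Then f(t) ≤ a·∑_{n=0}^∞ (b·Γ(μ))^n · t^{nμ} / Γ(nμ + 1) for almost every t ∈ (0,T); that is, f(t) ≤ a·E_{μ,1}(b·Γ(μ)·t^μ) where E_{μ,1} is the Mittag-Leffler function. -/
open MeasureTheory Set
open scoped ENNReal NNReal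

open ProbabilityTheory in
/-- Gamma densities with a common rate are stable under convolution. -/
lemma gammaPDF_lconvolution_gammaPDF {α β r x : ℝ} (hα : 0 < α) (hβ : 0 < β) (hr : 0 < r)
    (hx : 0 < x) :
    (gammaPDF α r ⋆ₗ gammaPDF β r) x = gammaPDF (α + β) r x := by
  have hΓ := Real.Gamma_pos_of_pos hα
  have hΓ' := Real.Gamma_pos_of_pos hβ
  have hΓ'' := Real.Gamma_pos_of_pos (add_pos hα hβ)
  have key : ∀ᵐ y : ℝ, gammaPDF α r y * gammaPDF β r (-y + x) =
      gammaPDF (α + β) r x * ENNReal.ofReal x⁻¹ * betaPDF α β (x⁻¹ * y) := by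
    filter_upwards [Measure.ae_ne volume 0, Measure.ae_ne volume x] with y hy0 hyx
    rcases hy0.lt_or_gt with hy | hy
    · rw [gammaPDF_of_neg hy, betaPDF_eq_zero_of_nonpos, zero_mul, mul_zero]
      exact mul_nonpos_of_nonneg_of_nonpos (by positivity) hy.le
    rcases hyx.lt_or_gt with hyx | hyx
    · have hlt : x⁻¹ * y < 1 := by rw [inv_mul_lt_iff₀ hx]; linarith
      rw [gammaPDF_of_nonneg hy.le, gammaPDF_of_nonneg (by linarith), gammaPDF_of_nonneg hx.le,
        betaPDF_of_pos_lt_one (by positivity) hlt, ← ENNReal.ofReal_mul (by positivity),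
        ← ENNReal.ofReal_mul (by positivity), ← ENNReal.ofReal_mul (by positivity)]
      congr 1
      have hxy : 1 - x⁻¹ * y = x⁻¹ * (-y + x) := by field_simp; ring
      have hexp : Real.exp (-(r * x)) = Real.exp (-(r * y)) * Real.exp (-(r * (-y + x))) := by
        rw [← Real.exp_add]; congr 1; ring
      have hxpow : x ^ (α + β - 1) = x ^ (α - 1) * x ^ (β - 1) * x := by
        rw [← Real.rpow_add hx, ← Real.rpow_add_one hx.ne']; congr 1; ring
      rw [hxy, Real.mul_rpow (by positivity) hy.le, Real.mul_rpow (by positivity) (by linarith),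
        Real.inv_rpow hx.le, Real.inv_rpow hx.le, hexp, hxpow, Real.rpow_add hr, beta]
      have h1 : 0 < x ^ (α - 1) := by positivity
      have h2 : 0 < x ^ (β - 1) := by positivity
      field_simp
    · rw [gammaPDF_of_neg (by linarith : -y + x < 0), betaPDF_eq_zero_of_one_le, mul_zero, mul_zero]
      rw [le_inv_mul_iff₀ hx]; linarith
  have hmeas : Measurable (betaPDF α β) := (measurable_betaPDFReal α β).ennreal_ofReal
  have hscale : ∫⁻ y, betaPDF α β (x⁻¹ * y) = ENNReal.ofReal x := by
    rw [← lintegral_map (f := betaPDF α β) (g := fun y => x⁻¹ * y) hmeas (by fun_prop),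
      Real.map_volume_mul_left (by positivity), lintegral_smul_measure,
      lintegral_betaPDF_eq_one hα hβ]
    simp [abs_of_pos hx]
  rw [lconvolution_def, lintegral_congr_ae key, lintegral_const_mul _ (by fun_prop), hscale,
    mul_assoc, ← ENNReal.ofReal_mul (by positivity), inv_mul_cancel₀ hx.ne', ENNReal.ofReal_one,
    mul_one]

lemma lintegral_lconvolution {G : Type*} [MeasurableSpace G] [AddGroup G] [MeasurableAdd₂ G]
    [MeasurableNeg G] {μ : Measure G} [μ.IsAddLeftInvariant] [SFinite μ] {f g : G → ℝ≥0∞}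
    (hf : AEMeasurable f μ) (hg : AEMeasurable g μ) :
    ∫⁻ x, (f ⋆ₗ[μ] g) x ∂μ = (∫⁻ x, f x ∂μ) * ∫⁻ x, g x ∂μ := by
  simp only [lconvolution_def]
  rw [lintegral_lintegral_swap (by fun_prop), ← lintegral_mul_const'' _ hf]
  refine lintegral_congr fun y => ?_
  have hgy : AEMeasurable (fun x => g (-y + x)) μ :=
    hg.comp_quasiMeasurePreserving (measurePreserving_add_left μ (-y)).quasiMeasurePreserving
  rw [lintegral_const_mul'' _ hgy, lintegral_add_left_eq_self]

/-- An integrable function dominated by a strict contraction of its convolution with a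
probability density vanishes. -/
lemma ae_eq_zero_of_le_const_mul_lconvolution {G : Type*} [MeasurableSpace G] [AddGroup G]
    [MeasurableAdd₂ G] [MeasurableNeg G] {μ : Measure G} [μ.IsAddLeftInvariant] [SFinite μ]
    {w g : G → ℝ≥0∞} {q : ℝ≥0∞}
    (hw : AEMeasurable w μ) (hg : AEMeasurable g μ) (hq : q < 1) (hg1 : ∫⁻ x, g x ∂μ = 1)
    (hfin : ∫⁻ x, w x ∂μ ≠ ∞) (hle : ∀ᵐ x ∂μ, w x ≤ q * (w ⋆ₗ[μ] g) x) :
    w =ᵐ[μ] 0 := by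
  have h : ∫⁻ x, w x ∂μ ≤ q * ∫⁻ x, w x ∂μ := by
    calc ∫⁻ x, w x ∂μ ≤ ∫⁻ x, q * (w ⋆ₗ[μ] g) x ∂μ := lintegral_mono_ae hle
      _ = q * ∫⁻ x, w x ∂μ := by
        rw [lintegral_const_mul'' _ (by fun_prop), lintegral_lconvolution hw hg, hg1, mul_one]
  rw [← lintegral_eq_zero_iff' hw]
  by_contra h0
  have := ENNReal.mul_lt_mul_left h0 hfin hq
  rw [one_mul] at this
  exact absurd h this.not_ge

/-- Up to the weight `exp (-r t)` and the factor `r`, this is the Mittag-Leffler function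
`E_{μ,1}(q r ^ μ t ^ μ)`. -/
noncomputable def tiltedMittagLeffler (μ r q t : ℝ) : ℝ≥0∞ :=
  ∑' n : ℕ, ENNReal.ofReal q ^ n * ProbabilityTheory.gammaPDF (n * μ + 1) r t

lemma measurable_gammaPDF (α r : ℝ) : Measurable (ProbabilityTheory.gammaPDF α r) :=
  (ProbabilityTheory.measurable_gammaPDFReal α r).ennreal_ofReal

lemma measurable_tiltedMittagLeffler (μ r q : ℝ) : Measurable (tiltedMittagLeffler μ r q) :=
  Measurable.tsum fun _ => (measurable_gammaPDF _ _).const_mul _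

lemma lintegral_tiltedMittagLeffler_ne_top {μ r q : ℝ} (hμ : 0 < μ) (hr : 0 < r) (hq : q < 1) :
    ∫⁻ t, tiltedMittagLeffler μ r q t ≠ ∞ := by
  unfold tiltedMittagLeffler
  rw [lintegral_tsum fun n => ((measurable_gammaPDF _ _).const_mul _).aemeasurable]
  have (n : ℕ) : ∫⁻ t, ENNReal.ofReal q ^ n * ProbabilityTheory.gammaPDF (n * μ + 1) r t =
      ENNReal.ofReal q ^ n := by
    rw [lintegral_const_mul _ (measurable_gammaPDF _ _),
      ProbabilityTheory.lintegral_gammaPDF_eq_one (by positivity) hr, mul_one]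
  simp_rw [this, ENNReal.tsum_geometric]
  exact ENNReal.inv_ne_top.2 (tsub_pos_of_lt (ENNReal.ofReal_lt_one.2 hq)).ne'

lemma tiltedMittagLeffler_eq {μ r q t : ℝ} (hμ : 0 < μ) (hr : 0 < r) (ht : 0 < t) :
    tiltedMittagLeffler μ r q t = ProbabilityTheory.gammaPDF 1 r t +
      ENNReal.ofReal q * (tiltedMittagLeffler μ r q ⋆ₗ ProbabilityTheory.gammaPDF μ r) t := by
  have hconv : (tiltedMittagLeffler μ r q ⋆ₗ ProbabilityTheory.gammaPDF μ r) t =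
      ∑' n : ℕ, ENNReal.ofReal q ^ n * ProbabilityTheory.gammaPDF ((n + 1 : ℕ) * μ + 1) r t := by
    simp only [lconvolution_def, tiltedMittagLeffler, ← ENNReal.tsum_mul_right]
    have hm := measurable_gammaPDF μ r
    rw [lintegral_tsum fun n => by
      have := measurable_gammaPDF (n * μ + 1) r
      fun_prop]
    refine tsum_congr fun n => ?_
    have hn := measurable_gammaPDF (n * μ + 1) r
    simp_rw [mul_assoc]
    rw [lintegral_const_mul _ (by fun_prop), ← lconvolution_def,
      gammaPDF_lconvolution_gammaPDF (by positivity) hμ hr ht]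
    congr 2
    push_cast
    ring
  rw [hconv, ← ENNReal.tsum_mul_left, tiltedMittagLeffler, tsum_eq_zero_add' ENNReal.summable]
  simp [pow_succ', mul_assoc]

/-- The Volterra inequality with power kernel, weighted by `exp (-r t)`. -/
lemma ofReal_exp_mul_le_of_le_integral_rpow {μ a b r t : ℝ} (hμ : 0 < μ) (ha : 0 < a)
    (hb : 0 < b) (hr : 0 < r) (ht : 0 < t) {f : ℝ → ℝ}
    (hf0 : ∀ᵐ s ∂volume.restrict (Ioo (0 : ℝ) t), 0 ≤ f s)
    (hineq : f t ≤ a + b * ∫ s in (0 : ℝ)..t, (t - s) ^ (μ - 1) * f s) {g : ℝ → ℝ≥0∞}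
    (hg : ∀ s ∈ Ioo 0 t, g s = ENNReal.ofReal (Real.exp (-(r * s)) * f s)) :
    ENNReal.ofReal (Real.exp (-(r * t)) * f t) ≤
      ENNReal.ofReal (a / r) * ProbabilityTheory.gammaPDF 1 r t +
        ENNReal.ofReal (b * Real.Gamma μ / r ^ μ) *
          (g ⋆ₗ ProbabilityTheory.gammaPDF μ r) t := by
  have hΓ := Real.Gamma_pos_of_pos hμ
  rw [intervalIntegral.integral_of_le ht.le, integral_Ioc_eq_integral_Ioo] at hineq
  set I := ∫ s in Ioo 0 t, (t - s) ^ (μ - 1) * f s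
  have hfirst : ENNReal.ofReal (a / r) * ProbabilityTheory.gammaPDF 1 r t =
      ENNReal.ofReal (Real.exp (-(r * t)) * a) := by
    rw [ProbabilityTheory.gammaPDF_of_nonneg ht.le, ← ENNReal.ofReal_mul (by positivity)]
    congr 1
    simp
    field_simp
  have hI : ENNReal.ofReal I ≤ ∫⁻ s in Ioo 0 t, ‖(t - s) ^ (μ - 1) * f s‖ₑ :=
    (Real.ofReal_le_enorm I).trans (enorm_integral_le_lintegral_enorm _)
  have hsecond : ENNReal.ofReal (Real.exp (-(r * t)) * b) * ENNReal.ofReal I ≤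
      ENNReal.ofReal (b * Real.Gamma μ / r ^ μ) *
        (g ⋆ₗ ProbabilityTheory.gammaPDF μ r) t := by
    refine (mul_le_mul_right hI _).trans ?_
    rw [lconvolution_def, ← lintegral_const_mul' _ _ ENNReal.ofReal_ne_top,
      ← lintegral_const_mul' _ _ ENNReal.ofReal_ne_top]
    refine le_trans (lintegral_mono_ae ?_) (setLIntegral_le_lintegral (Ioo 0 t) _)
    filter_upwards [hf0, ae_restrict_mem measurableSet_Ioo] with s hs hst
    have hts : 0 < t - s := by linarith [hst.2]
    have hexp : Real.exp (-(r * t)) = Real.exp (-(r * s)) * Real.exp (-(r * (t - s))) := by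
      rw [← Real.exp_add]; congr 1; ring
    rw [hg s hst, neg_add_eq_sub, ProbabilityTheory.gammaPDF_of_nonneg hts.le,
      Real.enorm_of_nonneg (by positivity), ← ENNReal.ofReal_mul (by positivity),
      ← ENNReal.ofReal_mul (by positivity), ← ENNReal.ofReal_mul (by positivity)]
    refine le_of_eq (congrArg _ ?_)
    rw [hexp]
    field_simp
  calc ENNReal.ofReal (Real.exp (-(r * t)) * f t)
      ≤ ENNReal.ofReal (Real.exp (-(r * t)) * a + Real.exp (-(r * t)) * b * I) := by
        refine ENNReal.ofReal_le_ofReal ?_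
        rw [mul_assoc, ← mul_add]
        gcongr
    _ ≤ ENNReal.ofReal (Real.exp (-(r * t)) * a) + ENNReal.ofReal (Real.exp (-(r * t)) * b * I) :=
        ENNReal.ofReal_add_le
    _ ≤ _ := by
        rw [ENNReal.ofReal_mul (p := Real.exp (-(r * t)) * b) (by positivity), hfirst]
        gcongr

lemma ofReal_pow_mul_gammaPDF {μ c r t : ℝ} (hμ : 0 < μ) (hc : 0 < c) (hr : 0 < r) (ht : 0 < t)
    (n : ℕ) :
    ENNReal.ofReal (c / r ^ μ) ^ n * ProbabilityTheory.gammaPDF (n * μ + 1) r t =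
      ENNReal.ofReal (r * Real.exp (-(r * t)) *
        (c ^ n * t ^ ((n : ℝ) * μ) / Real.Gamma ((n : ℝ) * μ + 1))) := by
  have hΓ : 0 < Real.Gamma (n * μ + 1) := Real.Gamma_pos_of_pos (by positivity)
  have hrn : r ^ (n * μ + 1) = (r ^ μ) ^ n * r := by
    rw [Real.rpow_add_one hr.ne', mul_comm (n : ℝ), Real.rpow_mul_natCast hr.le]
  have hrμ : 0 < r ^ μ := by positivity
  rw [ProbabilityTheory.gammaPDF_of_nonneg ht.le, ← ENNReal.ofReal_pow (by positivity),
    ← ENNReal.ofReal_mul (by positivity), add_sub_cancel_right, hrn, div_pow]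
  congr 1
  field_simp

/-- Where it is finite, `tiltedMittagLeffler` bounds the real series it is built from. -/
lemma le_mul_tsum_of_ofReal_exp_mul_le {μ a c r t y : ℝ} (hμ : 0 < μ) (ha : 0 < a) (hc : 0 < c)
    (hr : 0 < r) (ht : 0 < t) (hfin : tiltedMittagLeffler μ r (c / r ^ μ) t < ∞)
    (hle : ENNReal.ofReal (Real.exp (-(r * t)) * y) ≤
      ENNReal.ofReal (a / r) * tiltedMittagLeffler μ r (c / r ^ μ) t) :
    y ≤ a * ∑' n : ℕ, c ^ n * t ^ ((n : ℝ) * μ) / Real.Gamma ((n : ℝ) * μ + 1) := by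
  set m : ℕ → ℝ := fun n => c ^ n * t ^ ((n : ℝ) * μ) / Real.Gamma ((n : ℝ) * μ + 1)
  have hm (n : ℕ) : 0 ≤ m n := by
    have : 0 < Real.Gamma (n * μ + 1) := Real.Gamma_pos_of_pos (by positivity)
    positivity
  have hR : 0 < r * Real.exp (-(r * t)) := by positivity
  have hm' (n : ℕ) : 0 ≤ r * Real.exp (-(r * t)) * m n := mul_nonneg hR.le (hm n)
  have hE : tiltedMittagLeffler μ r (c / r ^ μ) t =
      ∑' n, ENNReal.ofReal (r * Real.exp (-(r * t)) * m n) :=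
    tsum_congr fun n => ofReal_pow_mul_gammaPDF hμ hc hr ht n
  rw [hE] at hfin hle
  have hsum : Summable fun n => r * Real.exp (-(r * t)) * m n := by
    simpa [ENNReal.toReal_ofReal (hm' _)] using ENNReal.summable_toReal hfin.ne
  rw [← ENNReal.ofReal_tsum_of_nonneg hm' hsum, ← ENNReal.ofReal_mul (by positivity),
    tsum_mul_left, ENNReal.ofReal_le_ofReal_iff
      (mul_nonneg (by positivity) (mul_nonneg hR.le (tsum_nonneg hm)))] at hle
  have hrew : a / r * (r * Real.exp (-(r * t)) * ∑' n, m n) =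
      Real.exp (-(r * t)) * (a * ∑' n, m n) := by field_simp
  rw [hrew] at hle
  exact le_of_mul_le_mul_left hle (Real.exp_pos _)

/-- Generalized Gronwall inequality (Lemma 5.1): if a nonnegative `f ∈ L¹(0,T)` satisfies
`f(t) ≤ a + b ∫_0^t (t-s)^{μ-1} f(s) ds` a.e., then
`f(t) ≤ a ∑_{n=0}^∞ (b Γ(μ))^n t^{nμ} / Γ(nμ+1) = a E_{μ,1}(b Γ(μ) t^μ)` a.e. -/
theorem generalized_gronwall (T μ a b : ℝ) (hT : 0 < T) (hμ : 0 < μ) (ha : 0 < a)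
    (hb : 0 < b) (f : ℝ → ℝ) (hf : IntegrableOn f (Ioo (0 : ℝ) T))
    (hf0 : ∀ᵐ t ∂volume.restrict (Ioo (0 : ℝ) T), 0 ≤ f t)
    (hineq : ∀ᵐ t ∂volume.restrict (Ioo (0 : ℝ) T),
      f t ≤ a + b * ∫ s in (0 : ℝ)..t, (t - s) ^ (μ - 1) * f s) :
    ∀ᵐ t ∂volume.restrict (Ioo (0 : ℝ) T),
      f t ≤ a * ∑' n : ℕ, (b * Real.Gamma μ) ^ n * t ^ ((n : ℝ) * μ) /
        Real.Gamma ((n : ℝ) * μ + 1) := by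
  have hc : 0 < b * Real.Gamma μ := mul_pos hb (Real.Gamma_pos_of_pos hμ)
  set c := b * Real.Gamma μ
  obtain ⟨r, hr, hrc⟩ : ∃ r : ℝ, 0 < r ∧ c / r ^ μ < 1 := by
    refine ⟨(2 * c) ^ μ⁻¹, by positivity, ?_⟩
    rw [Real.rpow_inv_rpow (by positivity) hμ.ne', div_lt_one (by positivity)]
    linarith
  set q := c / r ^ μ
  set F : ℝ → ℝ≥0∞ :=
    (Ioo 0 T).indicator fun t => ENNReal.ofReal (Real.exp (-(r * t)) * f t) with hF
  set U : ℝ → ℝ≥0∞ := fun t => ENNReal.ofReal (a / r) * tiltedMittagLeffler μ r q t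
  set W : ℝ → ℝ≥0∞ := fun t => F t - U t
  have hg := measurable_gammaPDF μ r
  have hE := measurable_tiltedMittagLeffler μ r q
  have hU : Measurable U := hE.const_mul _
  have hFm : AEMeasurable F := by
    rw [hF, aemeasurable_indicator_iff measurableSet_Ioo]
    have := hf.aemeasurable
    fun_prop
  have hW : AEMeasurable W := hFm.sub hU.aemeasurable
  have hFfin : ∫⁻ t, F t ≠ ∞ := by
    rw [hF, lintegral_indicator measurableSet_Ioo]
    refine ne_top_of_le_ne_top hf.hasFiniteIntegral.ne
      (setLIntegral_mono_ae' measurableSet_Ioo (ae_of_all _ fun t ht => ?_))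
    refine (Real.ofReal_le_enorm _).trans ?_
    rw [enorm_mul]
    refine mul_le_of_le_one_left' ?_
    rw [Real.enorm_of_nonneg (Real.exp_pos _).le, ENNReal.ofReal_le_one, Real.exp_le_one_iff]
    nlinarith [ht.1]
  have hWfin : ∫⁻ t, W t ≠ ∞ :=
    ne_top_of_le_ne_top hFfin (lintegral_mono fun t => tsub_le_self)
  have hWle : ∀ᵐ t, W t ≤ ENNReal.ofReal q * (W ⋆ₗ ProbabilityTheory.gammaPDF μ r) t := by
    filter_upwards [(ae_restrict_iff' measurableSet_Ioo).1 hineq] with t hineqt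
    by_cases ht : t ∈ Ioo 0 T
    swap
    · simp [W, F, ht]
    have hsub : Ioo 0 t ⊆ Ioo 0 T := Ioo_subset_Ioo_right ht.2.le
    have hFt := ofReal_exp_mul_le_of_le_integral_rpow hμ ha hb hr ht.1
      (ae_restrict_of_ae_restrict_of_subset hsub hf0) (hineqt ht) (g := F)
      fun s hs => indicator_of_mem (hsub hs) _
    have hUt : U t = ENNReal.ofReal (a / r) * ProbabilityTheory.gammaPDF 1 r t +
        ENNReal.ofReal q * (U ⋆ₗ ProbabilityTheory.gammaPDF μ r) t := by
      simp only [U]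
      rw [tiltedMittagLeffler_eq hμ hr ht.1, mul_add, mul_left_comm]
      simp only [lconvolution_def, mul_assoc]
      rw [lintegral_const_mul _ (by fun_prop)]
    have hconv : (F ⋆ₗ ProbabilityTheory.gammaPDF μ r) t ≤
        (W ⋆ₗ ProbabilityTheory.gammaPDF μ r) t + (U ⋆ₗ ProbabilityTheory.gammaPDF μ r) t := by
      simp only [lconvolution_def]
      rw [← lintegral_add_right _ (by fun_prop)]
      refine lintegral_mono fun s => ?_
      rw [← add_mul]
      gcongr
      exact le_tsub_add
    rw [tsub_le_iff_right, hUt, hF, indicator_of_mem ht, add_left_comm, ← mul_add]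
    refine hFt.trans ?_
    gcongr
  have hW0 := ae_eq_zero_of_le_const_mul_lconvolution hW hg.aemeasurable
    (ENNReal.ofReal_lt_one.2 hrc) (ProbabilityTheory.lintegral_gammaPDF_eq_one hμ hr) hWfin hWle
  have hEfin := ae_lt_top hE (lintegral_tiltedMittagLeffler_ne_top hμ hr hrc)
  rw [ae_restrict_iff' measurableSet_Ioo]
  filter_upwards [hW0, hEfin] with t hWt hEt ht
  refine le_mul_tsum_of_ofReal_exp_mul_le hμ ha hc hr ht.1 hEt ?_
  have hFU : F t ≤ U t := tsub_eq_zero_iff_le.1 hWt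
  rwa [hF, indicator_of_mem ht] at hFU
end

section
/- Let T > 0, α > 0 and C > 0. For a bounded measurable function w : [0,T] → ℝ define the Volterra operator H(w)(t) := C·∫_0^t (t-s)^{α-1} w(s) ds. Then for every n ≥ 1 and every t ∈ [0,T], the n-fold iterate satisfies |H^n(w)(t)| ≤ (C·Γ(α))^n · t^{nα} / Γ(nα + 1) · sup_{s ∈ [0,T]} |w(s)|. -/
open MeasureTheory Set
open scoped ENNReal NNReal

/-- The Beta integral rescaled to `[0,t]`, evaluated through Gamma functions. -/
theorem integral_sub_rpow_mul_rpow {a b t : ℝ} (ha : 0 < a) (hb : 0 < b) (ht : 0 < t) :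
    ∫ s in (0 : ℝ)..t, (t - s) ^ (a - 1) * s ^ (b - 1) =
      t ^ (b + a - 1) * (Real.Gamma b * Real.Gamma a / Real.Gamma (b + a)) := by
  have h := Complex.betaIntegral_scaled (b : ℂ) (a : ℂ) ht
  rw [Complex.betaIntegral_eq_Gamma_mul_div _ _ (by simpa using hb) (by simpa using ha)] at h
  apply Complex.ofReal_injective
  rw [← intervalIntegral.integral_ofReal]
  push_cast [Complex.ofReal_cpow ht.le, ← Complex.Gamma_ofReal]
  rw [← h]
  refine intervalIntegral.integral_congr fun s hs ↦ ?_
  rw [uIcc_of_le ht.le] at hs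
  rw [Complex.ofReal_cpow (sub_nonneg.2 hs.2), Complex.ofReal_cpow hs.1, mul_comm]
  push_cast
  rfl

/-- One application of the Volterra kernel to a function bounded by a power. -/
theorem abs_integral_sub_rpow_mul_le {a b t K : ℝ} (ha : 0 < a) (hb : 0 ≤ b) (ht : 0 < t)
    {f : ℝ → ℝ} (hf : ∀ s ∈ Icc 0 t, |f s| ≤ K * s ^ b) :
    |∫ s in (0 : ℝ)..t, (t - s) ^ (a - 1) * f s| ≤
      K * (t ^ (b + a) * (Real.Gamma (b + 1) * Real.Gamma a / Real.Gamma (b + a + 1))) := by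
  have hb' : 0 < b + 1 := by linarith
  have e := integral_sub_rpow_mul_rpow ha hb' ht
  rw [show b + 1 - 1 = b by ring, show b + 1 + a - 1 = b + a by ring,
    show b + 1 + a = b + a + 1 by ring] at e
  have hint : IntervalIntegrable (fun s ↦ (t - s) ^ (a - 1) * s ^ b) volume 0 t := by
    refine intervalIntegral.intervalIntegrable_of_integral_ne_zero ?_
    rw [e]
    have := Real.Gamma_pos_of_pos hb'
    have := Real.Gamma_pos_of_pos ha
    have := Real.Gamma_pos_of_pos (show 0 < b + a + 1 by linarith)
    positivity
  rw [← e, ← intervalIntegral.integral_const_mul, ← Real.norm_eq_abs]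
  refine intervalIntegral.norm_integral_le_of_norm_le ht.le (ae_of_all _ fun s hs ↦ ?_)
    (hint.const_mul K)
  have h0 : 0 ≤ (t - s) ^ (a - 1) := Real.rpow_nonneg (sub_nonneg.2 hs.2) _
  rw [Real.norm_eq_abs, abs_mul, abs_of_nonneg h0, mul_left_comm]
  exact mul_le_mul_of_nonneg_left (hf s ⟨hs.1.le, hs.2⟩) h0

/-- Iterated bound for the weakly singular Volterra operator
`H(w)(t) = C ∫_0^t (t-s)^{α-1} w(s) ds`: for every bounded measurable `w`, every `n ≥ 1`
and every `t ∈ [0,T]`,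
`|Hⁿ(w)(t)| ≤ (C Γ(α))ⁿ t^{nα} / Γ(nα+1) · sup_{s ∈ [0,T]} |w(s)|`. -/
theorem volterra_iterate_bound (T α C : ℝ) (hT : 0 < T) (hα : 0 < α) (hC : 0 < C)
    (H : (ℝ → ℝ) → (ℝ → ℝ))
    (hH : ∀ w t, H w t = C * ∫ s in (0 : ℝ)..t, (t - s) ^ (α - 1) * w s)
    (w : ℝ → ℝ) (hw : Measurable w) (hwb : ∃ M : ℝ, ∀ s ∈ Icc (0 : ℝ) T, |w s| ≤ M) :
    ∀ n : ℕ, 1 ≤ n → ∀ t ∈ Icc (0 : ℝ) T,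
      |H^[n] w t| ≤ (C * Real.Gamma α) ^ n * t ^ ((n : ℝ) * α) /
        Real.Gamma ((n : ℝ) * α + 1) * (⨆ s : Icc (0 : ℝ) T, |w s|) := by
  intro n _
  clear * - hα hC hH hwb
  induction n with
  | zero =>
    intro t ht
    obtain ⟨M, hM⟩ := hwb
    have hbdd : BddAbove (range fun s : Icc (0 : ℝ) T ↦ |w s|) :=
      ⟨M, by rintro _ ⟨s, rfl⟩; exact hM s s.2⟩
    simpa using le_ciSup hbdd ⟨t, ht⟩
  | succ n ih =>
    intro t ht
    rw [Function.iterate_succ_apply', hH]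
    rcases ht.1.eq_or_lt with rfl | h0
    · have hne : ((n + 1 : ℕ) : ℝ) * α ≠ 0 := by positivity
      rw [Real.zero_rpow hne]
      simp
    have hG := Real.Gamma_pos_of_pos (show 0 < (n : ℝ) * α + 1 by positivity)
    set S := ⨆ s : Icc (0 : ℝ) T, |w s|
    have key := abs_integral_sub_rpow_mul_le (b := n * α) (f := H^[n] w)
      (K := (C * Real.Gamma α) ^ n / Real.Gamma (n * α + 1) * S) hα (by positivity) h0
      fun s hs ↦ (ih s ⟨hs.1, hs.2.trans ht.2⟩).trans_eq (by ring)
    rw [abs_mul, abs_of_pos hC]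
    refine (mul_le_mul_of_nonneg_left key hC.le).trans_eq ?_
    rw [show ((n + 1 : ℕ) : ℝ) * α = n * α + α by push_cast; ring]
    field_simp
    ring
end

section
/- Let T > 0, α > 0 and C > 0. Let h, u ∈ L^1(0,T) be nonnegative measurable functions satisfying u(t) ≤ C·∫_0^t (t-s)^{α-1} u(s) ds + C·∫_0^t (t-s)^{α-1} h(s) ds for almost every t ∈ (0,T). Then there exists a constant C' > 0, depending only on C, α and T, such that u(t) ≤ C'·∫_0^t (t-s)^{α-1} h(s) ds for almost every t ∈ (0,T). -/
open MeasureTheory Set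
open scoped ENNReal NNReal

/-- The Riemann–Liouville kernel `x ^ (γ - 1)`, truncated to `(0, T)`. -/
noncomputable def rlKernel (T γ : ℝ) : ℝ → ℝ≥0∞ :=
  (Ioo (0 : ℝ) T).indicator fun x => ENNReal.ofReal (x ^ (γ - 1))

lemma rlKernel_of_mem {T γ x : ℝ} (hx : x ∈ Ioo (0 : ℝ) T) :
    rlKernel T γ x = ENNReal.ofReal (x ^ (γ - 1)) := indicator_of_mem hx _

lemma rlKernel_of_notMem {T γ x : ℝ} (hx : x ∉ Ioo (0 : ℝ) T) :
    rlKernel T γ x = 0 := indicator_of_notMem hx _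

@[fun_prop]
lemma measurable_rlKernel (T γ : ℝ) : Measurable (rlKernel T γ) :=
  Measurable.indicator (by fun_prop) measurableSet_Ioo

lemma lintegral_rlKernel_ne_top {T γ : ℝ} (hT : 0 < T) (hγ : 0 < γ) :
    ∫⁻ x, rlKernel T γ x ≠ ∞ := by
  have hi : IntegrableOn (fun x : ℝ => x ^ (γ - 1)) (Ioo 0 T) :=
    ((intervalIntegrable_iff_integrableOn_Ioc_of_le hT.le).1
      (intervalIntegral.intervalIntegrable_rpow' (by linarith))).mono_set Ioo_subset_Ioc_self
  unfold rlKernel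
  rw [lintegral_indicator measurableSet_Ioo]
  exact hi.lintegral_lt_top.ne

lemma lintegral_lconvolution_s13 {f g : ℝ → ℝ≥0∞} (hf : AEMeasurable f) (hg : Measurable g) :
    ∫⁻ x, (f ⋆ₗ g) x = (∫⁻ x, f x) * ∫⁻ x, g x := by
  simp only [lconvolution_def]
  rw [lintegral_lintegral_swap (by fun_prop), ← lintegral_mul_const'' _ hf]
  refine lintegral_congr fun y => ?_
  rw [lintegral_const_mul _ (by fun_prop), lintegral_add_left_eq_self g]

lemma lintegral_betaPDF_comp_mul {α β c : ℝ} (hα : 0 < α) (hβ : 0 < β) (hc : 0 < c) :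
    ∫⁻ y, ProbabilityTheory.betaPDF α β (c * y) = ENNReal.ofReal c⁻¹ := by
  have hm : Measurable (ProbabilityTheory.betaPDF α β) :=
    (ProbabilityTheory.measurable_betaPDFReal α β).ennreal_ofReal
  rw [← lintegral_map hm (measurable_const_mul c), Real.map_volume_mul_left hc.ne',
    lintegral_smul_measure, ProbabilityTheory.lintegral_betaPDF_eq_one hα hβ,
    abs_of_pos (inv_pos.2 hc)]
  simp

lemma rlKernel_lconvolution_le {T α β x : ℝ} (hα : 0 < α) (hβ : 0 < β) (hx : x < T) :
    (rlKernel T α ⋆ₗ rlKernel T β) x ≤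
      ENNReal.ofReal (ProbabilityTheory.beta α β * T ^ β) * rlKernel T α x := by
  have hB := ProbabilityTheory.beta_pos hα hβ
  rcases le_or_gt x 0 with hx0 | hx0
  · rw [lconvolution_def, lintegral_eq_zero_of_ae_eq_zero]
    · exact zero_le
    · refine Filter.Eventually.of_forall fun y => ?_
      by_cases hy : y ∈ Ioo (0 : ℝ) T
      · simp [rlKernel_of_notMem (T := T) (γ := β) (x := -y + x)
          (fun h => by linarith [h.1, hy.1])]
      · simp [rlKernel_of_notMem hy]
  · have key : ∀ y, rlKernel T α y * rlKernel T β (-y + x) ≤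
        ENNReal.ofReal (ProbabilityTheory.beta α β * (x ^ (α - 1) * x ^ (β - 1))) *
          ProbabilityTheory.betaPDF α β (x⁻¹ * y) := by
      intro y
      by_cases hy : y ∈ Ioo (0 : ℝ) T
      swap
      · simp [rlKernel_of_notMem hy]
      by_cases hyx : -y + x ∈ Ioo (0 : ℝ) T
      swap
      · simp [rlKernel_of_notMem hyx]
      have hyx' : y < x := by linarith [hyx.1]
      have h1 : x⁻¹ * y < 1 := by
        rw [inv_mul_lt_iff₀ hx0]; linarith
      have h0 : 0 < x⁻¹ * y := mul_pos (inv_pos.2 hx0) hy.1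
      rw [rlKernel_of_mem hy, rlKernel_of_mem hyx, ProbabilityTheory.betaPDF_of_pos_lt_one h0 h1,
        ← ENNReal.ofReal_mul (Real.rpow_nonneg hy.1.le _), ← ENNReal.ofReal_mul (by positivity)]
      refine ENNReal.ofReal_le_ofReal (le_of_eq ?_)
      have e1 : y ^ (α - 1) = x ^ (α - 1) * (x⁻¹ * y) ^ (α - 1) := by
        rw [← Real.mul_rpow hx0.le h0.le]; congr 1; field_simp
      have e2 : (-y + x) ^ (β - 1) = x ^ (β - 1) * (1 - x⁻¹ * y) ^ (β - 1) := by
        rw [← Real.mul_rpow hx0.le (by linarith)]; congr 1; field_simp; ring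
      rw [e1, e2]
      field_simp
    rw [lconvolution_def]
    refine (lintegral_mono key).trans ?_
    rw [lintegral_const_mul' _ _ ENNReal.ofReal_ne_top,
      lintegral_betaPDF_comp_mul hα hβ (inv_pos.2 hx0), inv_inv, rlKernel_of_mem ⟨hx0, hx⟩,
      ← ENNReal.ofReal_mul (by positivity),
      ← ENNReal.ofReal_mul (mul_nonneg hB.le (Real.rpow_nonneg (by linarith) _))]
    refine ENNReal.ofReal_le_ofReal ?_
    have e3 : x ^ (β - 1) * x = x ^ β := by
      rw [← Real.rpow_add_one hx0.ne']; simp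
    have e4 : x ^ β ≤ T ^ β := Real.rpow_le_rpow hx0.le hx.le hβ.le
    calc _ = ProbabilityTheory.beta α β * x ^ (α - 1) * (x ^ (β - 1) * x) := by ring
      _ ≤ ProbabilityTheory.beta α β * x ^ (α - 1) * T ^ β := by rw [e3]; gcongr
      _ = _ := by ring

/-- An exponential weight trades half of the order of the kernel for a small constant. -/
lemma exists_exp_mul_rpow_le {β δ : ℝ} (hβ : 0 < β) (hδ : 0 < δ) :
    ∃ l > (0 : ℝ), ∀ x > (0 : ℝ), Real.exp (-(l * x)) * x ^ β ≤ δ := by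
  refine ⟨β * δ ^ (-β⁻¹), by positivity, fun x hx => ?_⟩
  have h1 : δ ^ (-β⁻¹) * x ≤ Real.exp (δ ^ (-β⁻¹) * x) := by
    linarith [Real.add_one_le_exp (δ ^ (-β⁻¹) * x)]
  have h2 := Real.rpow_le_rpow (by positivity) h1 hβ.le
  rw [Real.mul_rpow (by positivity) hx.le, ← Real.rpow_mul hδ.le, ← Real.exp_mul] at h2
  rw [show -β⁻¹ * β = -1 by field_simp, Real.rpow_neg_one] at h2
  rw [Real.exp_neg, show β * δ ^ (-β⁻¹) * x = δ ^ (-β⁻¹) * x * β by ring,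
    inv_mul_le_iff₀ (Real.exp_pos _)]
  rw [inv_mul_le_iff₀ hδ] at h2
  linarith

lemma exp_mul_rlKernel_le {T α β δ l : ℝ}
    (hl : ∀ x > (0 : ℝ), Real.exp (-(l * x)) * x ^ β ≤ δ) (x : ℝ) :
    ENNReal.ofReal (Real.exp (-(l * x))) * rlKernel T (α + β) x ≤
      ENNReal.ofReal δ * rlKernel T α x := by
  by_cases hx : x ∈ Ioo (0 : ℝ) T
  swap
  · simp [rlKernel_of_notMem hx]
  have hx0 := hx.1
  rw [rlKernel_of_mem hx, rlKernel_of_mem hx, ← ENNReal.ofReal_mul (by positivity),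
    ← ENNReal.ofReal_mul' (by positivity)]
  refine ENNReal.ofReal_le_ofReal ?_
  rw [show α + β - 1 = β + (α - 1) by ring, Real.rpow_add hx0, ← mul_assoc]
  gcongr
  exact hl x hx0

/-- Comparison principle: an integrable subsolution of `V = V ⋆ a + D` with `a` small lies below
the supersolution `2 D`. -/
lemma ae_le_two_mul_of_le_lconvolution_add {V D a : ℝ → ℝ≥0∞} (hV : AEMeasurable V)
    (hD : AEMeasurable D) (ha : Measurable a) (hVtop : ∫⁻ t, V t ≠ ∞)
    (ha_le : ∫⁻ x, a x ≤ 1 / 2)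
    (h : ∀ᵐ t, V t ≠ 0 → V t ≤ (V ⋆ₗ a) t + D t ∧ 2 * (D ⋆ₗ a) t ≤ D t) :
    ∀ᵐ t, V t ≤ 2 * D t := by
  set w : ℝ → ℝ≥0∞ := fun t => V t - 2 * D t with hw
  have hwm : AEMeasurable w := hV.sub (hD.const_mul 2)
  have hconv : ∀ t, (V ⋆ₗ a) t ≤ (w ⋆ₗ a) t + 2 * (D ⋆ₗ a) t := by
    intro t
    have hDa : AEMeasurable fun y => D y * a (-y + t) := by fun_prop
    simp only [lconvolution_def]
    rw [← lintegral_const_mul'' _ hDa, ← lintegral_add_right' _ (hDa.const_mul 2)]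
    refine lintegral_mono fun y => ?_
    rw [← mul_assoc, ← add_mul]
    exact mul_le_mul_left le_tsub_add _
  have hle : ∀ᵐ t, w t ≤ (w ⋆ₗ a) t := by
    filter_upwards [h] with t ht
    by_cases h0 : V t = 0
    · simp [hw, h0]
    obtain ⟨h1, h2⟩ := ht h0
    refine tsub_le_iff_right.2 (h1.trans ?_)
    rw [two_mul, ← add_assoc]
    gcongr
    exact (hconv t).trans (by gcongr)
  have hwtop : ∫⁻ t, w t ≠ ∞ := ne_top_of_le_ne_top hVtop (lintegral_mono fun t => tsub_le_self)
  have hhalf : ∫⁻ t, w t ≤ (∫⁻ t, w t) / 2 := by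
    refine (lintegral_mono_ae hle).trans ?_
    rw [lintegral_lconvolution_s13 hwm ha, div_eq_mul_one_div]
    gcongr
  have hzero : ∫⁻ t, w t = 0 := by
    by_contra hne
    exact absurd hhalf (not_le.2 (ENNReal.half_lt_self hne hwtop))
  filter_upwards [(lintegral_eq_zero_iff' hwm).1 hzero] with t ht
  exact tsub_eq_zero_iff_le.1 ht

/-- The positive part of `f` on `(0, T)`, extended by zero. -/
noncomputable def zeroExtend (T : ℝ) (f : ℝ → ℝ) : ℝ → ℝ≥0∞ :=
  (Ioo (0 : ℝ) T).indicator fun x => ENNReal.ofReal (f x)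

lemma aemeasurable_zeroExtend {T : ℝ} {f : ℝ → ℝ} (hf : IntegrableOn f (Ioo (0 : ℝ) T)) :
    AEMeasurable (zeroExtend T f) :=
  (aemeasurable_indicator_iff measurableSet_Ioo).2 hf.aemeasurable.ennreal_ofReal

lemma lintegral_zeroExtend_ne_top {T : ℝ} {f : ℝ → ℝ} (hf : IntegrableOn f (Ioo (0 : ℝ) T)) :
    ∫⁻ x, zeroExtend T f x ≠ ∞ := by
  unfold zeroExtend
  rw [lintegral_indicator measurableSet_Ioo]
  exact hf.lintegral_lt_top.ne

lemma zeroExtend_lconvolution_rlKernel {T α t : ℝ} (f : ℝ → ℝ) (ht : t ∈ Ioo (0 : ℝ) T) :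
    (zeroExtend T f ⋆ₗ rlKernel T α) t =
      ∫⁻ s in Ioo 0 t, ENNReal.ofReal ((t - s) ^ (α - 1) * f s) := by
  rw [lconvolution_def, ← lintegral_indicator measurableSet_Ioo]
  refine lintegral_congr fun s => ?_
  by_cases hs : s ∈ Ioo 0 t
  · have h1 : s ∈ Ioo (0 : ℝ) T := ⟨hs.1, hs.2.trans ht.2⟩
    have h2 : -s + t ∈ Ioo (0 : ℝ) T := ⟨by linarith [hs.2], by linarith [hs.1, ht.2]⟩
    rw [indicator_of_mem hs, rlKernel_of_mem h2, zeroExtend, indicator_of_mem h1, mul_comm,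
      ← ENNReal.ofReal_mul (Real.rpow_nonneg h2.1.le _), show -s + t = t - s by ring]
  · rw [indicator_of_notMem hs]
    by_cases h1 : s ∈ Ioo (0 : ℝ) T
    · rw [rlKernel_of_notMem (x := -s + t) fun h => hs ⟨h1.1, by linarith [h.1]⟩, mul_zero]
    · rw [zeroExtend, indicator_of_notMem h1, zero_mul]

lemma integral_rpow_mul_eq_toReal {T α t : ℝ} {f : ℝ → ℝ} (hf : IntegrableOn f (Ioo (0 : ℝ) T))
    (hf0 : ∀ᵐ s ∂volume.restrict (Ioo (0 : ℝ) T), 0 ≤ f s) (ht : t ∈ Ioo (0 : ℝ) T) :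
    ∫ s in (0 : ℝ)..t, (t - s) ^ (α - 1) * f s =
      ((zeroExtend T f ⋆ₗ rlKernel T α) t).toReal := by
  have hsub : Ioo 0 t ⊆ Ioo 0 T := Ioo_subset_Ioo_right ht.2.le
  rw [zeroExtend_lconvolution_rlKernel f ht, intervalIntegral.integral_of_le ht.1.le,
    integral_Ioc_eq_integral_Ioo]
  refine integral_eq_lintegral_of_nonneg_ae ?_ ?_
  · filter_upwards [ae_restrict_of_ae_restrict_of_subset hsub hf0,
      ae_restrict_mem measurableSet_Ioo] with s hs hst
    exact mul_nonneg (Real.rpow_nonneg (by linarith [hst.2]) _) hs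
  · exact AEStronglyMeasurable.mul
      (Measurable.aestronglyMeasurable (by fun_prop)) (hf.mono_set hsub).aestronglyMeasurable

lemma ae_zeroExtend_lconvolution_rlKernel_ne_top {T α : ℝ} (hT : 0 < T) (hα : 0 < α)
    {f : ℝ → ℝ} (hf : IntegrableOn f (Ioo (0 : ℝ) T)) :
    ∀ᵐ t, (zeroExtend T f ⋆ₗ rlKernel T α) t ≠ ∞ := by
  have hm := aemeasurable_zeroExtend hf
  refine (ae_lt_top' (aemeasurable_lconvolution hm (by fun_prop)) ?_).mono fun t ht => ht.ne
  rw [lintegral_lconvolution_s13 hm (by fun_prop)]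
  exact ENNReal.mul_ne_top (lintegral_zeroExtend_ne_top hf) (lintegral_rlKernel_ne_top hT hα)

/-- A weight `exp (-l x)` makes the kernel `C x ^ (α - 1)` small, both in `L¹` and as a convolution
operator on the unweighted kernel. -/
lemma exists_weight {T α C : ℝ} (hT : 0 < T) (hα : 0 < α) (hC : 0 < C) :
    ∃ l > (0 : ℝ), ∃ a : ℝ → ℝ≥0∞, Measurable a ∧
      (∀ x, a x = ENNReal.ofReal C * ENNReal.ofReal (Real.exp (-(l * x))) * rlKernel T α x) ∧
      ∫⁻ x, a x ≤ 1 / 2 ∧ ∀ x < T, 2 * (rlKernel T α ⋆ₗ a) x ≤ rlKernel T α x := by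
  have hα2 : 0 < α / 2 := by positivity
  set M := ENNReal.ofReal (ProbabilityTheory.beta α (α / 2) * T ^ (α / 2))
  set J := ∫⁻ x, rlKernel T (α / 2) x
  have hJ : J ≠ ∞ := lintegral_rlKernel_ne_top hT hα2
  have hN : J + M ≠ ∞ := ENNReal.add_ne_top.2 ⟨hJ, ENNReal.ofReal_ne_top⟩
  set n := (J + M).toReal
  have hn : 0 ≤ n := ENNReal.toReal_nonneg
  obtain ⟨l, hl0, hl⟩ := exists_exp_mul_rpow_le hα2 (δ := 1 / (2 * C * (n + 1))) (by positivity)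
  set ε := ENNReal.ofReal (1 / (2 * (n + 1))) with hε
  have hεN : ε * (J + M) ≤ 1 / 2 := by
    rw [← ENNReal.ofReal_toReal hN, hε, ← ENNReal.ofReal_mul (by positivity),
      show (1 / 2 : ℝ≥0∞) = ENNReal.ofReal (1 / 2) by
        rw [ENNReal.ofReal_div_of_pos two_pos]; simp]
    refine ENNReal.ofReal_le_ofReal ?_
    change 1 / (2 * (n + 1)) * n ≤ 1 / 2
    rw [div_mul_eq_mul_div, div_le_div_iff₀ (by positivity) (by positivity)]
    linarith
  let a : ℝ → ℝ≥0∞ := fun x =>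
    ENNReal.ofReal C * ENNReal.ofReal (Real.exp (-(l * x))) * rlKernel T α x
  have ha : ∀ x, a x ≤ ε * rlKernel T (α / 2) x := by
    intro x
    have := exp_mul_rlKernel_le (T := T) (α := α / 2) hl x
    rw [add_halves] at this
    calc a x = ENNReal.ofReal C *
          (ENNReal.ofReal (Real.exp (-(l * x))) * rlKernel T α x) := mul_assoc _ _ _
      _ ≤ ENNReal.ofReal C *
          (ENNReal.ofReal (1 / (2 * C * (n + 1))) * rlKernel T (α / 2) x) := by gcongr
      _ = _ := by
        rw [← mul_assoc, ← ENNReal.ofReal_mul hC.le, hε]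
        congr 2
        field_simp
  refine ⟨l, hl0, a, by fun_prop, fun x => rfl, ?_, fun x hx => ?_⟩
  · refine (lintegral_mono ha).trans ?_
    rw [lintegral_const_mul _ (by fun_prop)]
    exact (mul_le_mul_right le_self_add _).trans hεN
  · have h1 : (rlKernel T α ⋆ₗ a) x ≤ ε * (rlKernel T α ⋆ₗ rlKernel T (α / 2)) x := by
      simp only [lconvolution_def]
      rw [← lintegral_const_mul _ (by fun_prop)]
      refine lintegral_mono fun y => ?_
      rw [mul_left_comm ε]
      exact mul_le_mul' le_rfl (ha _)
    calc 2 * (rlKernel T α ⋆ₗ a) x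
        ≤ 2 * (ε * (M * rlKernel T α x)) := by
          gcongr
          refine h1.trans ?_
          gcongr
          exact rlKernel_lconvolution_le hα hα2 hx
      _ ≤ 2 * (ε * ((J + M) * rlKernel T α x)) := by gcongr; exact le_add_self
      _ = 2 * (ε * (J + M)) * rlKernel T α x := by ring
      _ ≤ 2 * (1 / 2) * rlKernel T α x := by gcongr
      _ = rlKernel T α x := by
        rw [one_div, ENNReal.mul_inv_cancel two_ne_zero ENNReal.ofNat_ne_top, one_mul]

/-- Absorption step: if nonnegative `h, u ∈ L¹(0,T)` satisfy
`u(t) ≤ C ∫_0^t (t-s)^{α-1} u(s) ds + C ∫_0^t (t-s)^{α-1} h(s) ds` a.e., then there is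
`C' > 0`, depending only on `C`, `α` and `T`, with
`u(t) ≤ C' ∫_0^t (t-s)^{α-1} h(s) ds` a.e. -/
theorem gronwall_absorption (T α C : ℝ) (hT : 0 < T) (hα : 0 < α) (hC : 0 < C) :
    ∃ C' > (0 : ℝ), ∀ h u : ℝ → ℝ,
      IntegrableOn h (Ioo (0 : ℝ) T) → IntegrableOn u (Ioo (0 : ℝ) T) →
      (∀ᵐ t ∂volume.restrict (Ioo (0 : ℝ) T), 0 ≤ h t) →
      (∀ᵐ t ∂volume.restrict (Ioo (0 : ℝ) T), 0 ≤ u t) →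
      (∀ᵐ t ∂volume.restrict (Ioo (0 : ℝ) T),
        u t ≤ C * (∫ s in (0 : ℝ)..t, (t - s) ^ (α - 1) * u s) +
          C * ∫ s in (0 : ℝ)..t, (t - s) ^ (α - 1) * h s) →
      (∀ᵐ t ∂volume.restrict (Ioo (0 : ℝ) T),
        u t ≤ C' * ∫ s in (0 : ℝ)..t, (t - s) ^ (α - 1) * h s) := by
  obtain ⟨l, hl, a, ham, ha, ha_int, ha_conv⟩ := exists_weight hT hα hC
  refine ⟨2 * C * Real.exp (l * T), by positivity, fun h u hh hu hh0 hu0 hineq => ?_⟩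
  set k := rlKernel T α with hk
  have hkm : Measurable k := measurable_rlKernel T α
  set e : ℝ → ℝ≥0∞ := fun x => ENNReal.ofReal (Real.exp (-(l * x))) with he
  have hem : Measurable e := by fun_prop
  have he_top : ∀ x, e x ≠ ∞ := fun x => ENNReal.ofReal_ne_top
  have he_anti : Antitone e := fun x y hxy => ENNReal.ofReal_le_ofReal
    (Real.exp_le_exp.2 (neg_le_neg (mul_le_mul_of_nonneg_left hxy hl.le)))
  have he_le : ∀ x, 0 ≤ x → e x ≤ 1 := fun x hx => by
    simpa [he] using he_anti hx
  have he_add : ∀ x y, e y * e (-y + x) = e x := fun x y => by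
    simp only [he]
    rw [← ENNReal.ofReal_mul (Real.exp_pos _).le, ← Real.exp_add]
    congr 2
    ring
  set c := ENNReal.ofReal C with hc
  have hc_top : c ≠ ∞ := ENNReal.ofReal_ne_top
  have hUm := aemeasurable_zeroExtend hu
  have hHm := aemeasurable_zeroExtend hh
  set U := zeroExtend T u with hU
  set H := zeroExtend T h with hH
  have hU_out : ∀ x, x ∉ Ioo (0 : ℝ) T → U x = 0 := fun x hx => indicator_of_notMem hx _
  have hH_out : ∀ x, x ∉ Ioo (0 : ℝ) T → H x = 0 := fun x hx => indicator_of_notMem hx _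
  set V : ℝ → ℝ≥0∞ := fun x => e x * U x with hV
  set G : ℝ → ℝ≥0∞ := fun x => c * (e x * H x) with hG
  have hGm : AEMeasurable G := by fun_prop
  have hVm : AEMeasurable V := by fun_prop
  have hVtop : ∫⁻ t, V t ≠ ∞ := by
    refine ne_top_of_le_ne_top (lintegral_zeroExtend_ne_top hu) (lintegral_mono fun t => ?_)
    by_cases ht : t ∈ Ioo (0 : ℝ) T
    · exact mul_le_of_le_one_left' (he_le t ht.1.le)
    · simp [hV, hU_out t ht]
  have hVa : ∀ t, e t * (c * (U ⋆ₗ k) t) = (V ⋆ₗ a) t := by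
    intro t
    simp only [lconvolution_def]
    rw [← lintegral_const_mul' _ _ hc_top, ← lintegral_const_mul' _ _ (he_top t)]
    refine lintegral_congr fun y => ?_
    rw [ha, ← he_add t y]
    simp only [hV]
    ring
  have hGk : ∀ t, e t * (c * (H ⋆ₗ k) t) ≤ (G ⋆ₗ k) t := by
    intro t
    simp only [lconvolution_def]
    rw [← lintegral_const_mul' _ _ hc_top, ← lintegral_const_mul' _ _ (he_top t)]
    refine lintegral_mono fun y => ?_
    by_cases hy : -y + t ∈ Ioo (0 : ℝ) T
    · calc e t * (c * (H y * k (-y + t))) ≤ e y * (c * (H y * k (-y + t))) := by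
            gcongr
            exact he_anti (by linarith [hy.1])
        _ = G y * k (-y + t) := by simp only [hG]; ring
    · simp [hk, rlKernel_of_notMem hy]
  have hGH : ∀ t, (G ⋆ₗ k) t ≤ c * (H ⋆ₗ k) t := by
    intro t
    simp only [lconvolution_def]
    rw [← lintegral_const_mul' _ _ hc_top]
    refine lintegral_mono fun y => ?_
    rw [← mul_assoc]
    gcongr
    by_cases hy : y ∈ Ioo (0 : ℝ) T
    · exact mul_le_mul_right (mul_le_of_le_one_left' (he_le y hy.1.le)) _
    · simp [hG, hH_out y hy]
  have hGka : ∀ t < T, 2 * ((G ⋆ₗ k) ⋆ₗ a) t ≤ (G ⋆ₗ k) t := by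
    intro t ht
    rw [← lconvolution_assoc₀ hGm hkm.aemeasurable ham.aemeasurable, lconvolution_def,
      lconvolution_def, ← lintegral_const_mul' _ _ ENNReal.ofNat_ne_top]
    refine lintegral_mono fun y => ?_
    by_cases hy : y ∈ Ioo (0 : ℝ) T
    · rw [mul_left_comm]
      gcongr
      exact ha_conv _ (by linarith [hy.1])
    · simp [hG, hH_out y hy]
  have hmain : ∀ᵐ t, V t ≤ 2 * (G ⋆ₗ k) t := by
    refine ae_le_two_mul_of_le_lconvolution_add hVm
      (aemeasurable_lconvolution hGm hkm.aemeasurable) ham hVtop ha_int ?_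
    filter_upwards [(ae_restrict_iff' measurableSet_Ioo).1 hineq] with t ht hVt
    have htm : t ∈ Ioo (0 : ℝ) T := by
      by_contra hne
      exact hVt (by simp [hV, hU_out t hne])
    refine ⟨?_, hGka t htm.2⟩
    have h1 := ht htm
    rw [integral_rpow_mul_eq_toReal hu hu0 htm, integral_rpow_mul_eq_toReal hh hh0 htm] at h1
    have h2 : U t ≤ c * (U ⋆ₗ k) t + c * (H ⋆ₗ k) t := by
      rw [hU, zeroExtend, indicator_of_mem htm]
      refine (ENNReal.ofReal_le_ofReal h1).trans (ENNReal.ofReal_add_le.trans ?_)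
      rw [ENNReal.ofReal_mul hC.le, ENNReal.ofReal_mul hC.le]
      gcongr <;> exact ENNReal.ofReal_toReal_le
    calc V t ≤ e t * (c * (U ⋆ₗ k) t + c * (H ⋆ₗ k) t) := by simp only [hV]; gcongr
      _ = (V ⋆ₗ a) t + e t * (c * (H ⋆ₗ k) t) := by rw [mul_add, hVa]
      _ ≤ _ := by gcongr; exact hGk t
  rw [ae_restrict_iff' measurableSet_Ioo]
  filter_upwards [hmain, ae_zeroExtend_lconvolution_rlKernel_ne_top hT hα hh] with t ht htop htm
  rw [integral_rpow_mul_eq_toReal hh hh0 htm]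
  set X := ((H ⋆ₗ k) t).toReal with hX
  have hX0 : 0 ≤ X := ENNReal.toReal_nonneg
  have h3 : ENNReal.ofReal (Real.exp (-(l * t)) * u t) ≤ ENNReal.ofReal (2 * (C * X)) := by
    rw [ENNReal.ofReal_mul (Real.exp_pos _).le, ENNReal.ofReal_mul zero_le_two,
      ENNReal.ofReal_mul hC.le, hX, ENNReal.ofReal_toReal htop, ENNReal.ofReal_ofNat]
    have hVt : V t = ENNReal.ofReal (Real.exp (-(l * t))) * ENNReal.ofReal (u t) := by
      simp only [hV, hU, zeroExtend, indicator_of_mem htm, he]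
    rw [← hVt]
    exact ht.trans (by gcongr; exact hGH t)
  have h4 := (ENNReal.ofReal_le_ofReal_iff (by positivity)).1 h3
  rw [Real.exp_neg, inv_mul_le_iff₀ (Real.exp_pos _)] at h4
  calc u t ≤ Real.exp (l * t) * (2 * (C * X)) := h4
    _ ≤ Real.exp (l * T) * (2 * (C * X)) := by
      gcongr
      exact htm.2.le
    _ = 2 * C * Real.exp (l * T) * X := by ring
end
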